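/- Suppose q ≥ 3, r = 2m+1 is coprime to q, and m > (q+5)/2. Set i₋ = q/2 − 1 and i₊ = q/2 + 1 if q is even, and i₋ = m − (q+1)/2 and i₊ = m − (q−3)/2 if q is odd. Then for every row index i with 1 ≤ i ≤ m and i ∉ {i₋, i₊}, row i of the matrix R contains exactly two nonzero entries. -/

import Mathlib

open scoped Classical

/-- The reduced index `ρ(n) = min(n % r, r − n % r)`. -/
noncomputable def rho (r n : ℕ) : ℕ := min (n % r) (r - n % r)

/-- The sign `σ(n) = (−1)^⌊n/r⌋`. -/
noncomputable def sgn (r n : ℕ) : ℤ := (-1) ^ (n / r)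

/-- The entry of the matrix `R` in row (labelled) `i ∈ {1,…,m}` and column `l ∈ {0,…,m−1}`:
column `0` is `e_1`, and for `1 ≤ l ≤ m−1` the column is the reduction of
`f_l = e_{ql+1} − A^{2pl} e_{ql−1}`. -/
noncomputable def Rent (m q : ℕ) (p : ℤ) (A : ℂ) (i l : ℕ) : ℂ :=
  if l = 0 then (if i = 1 then 1 else 0)
  else
    (if rho (2*m+1) (q*l+1) = i then ((sgn (2*m+1) (q*l+1) : ℤ) : ℂ) else 0)
      - A ^ (2 * p * (l : ℤ)) *
        (if rho (2*m+1) (q*l-1) = i then ((sgn (2*m+1) (q*l-1) : ℤ) : ℂ) else 0)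

/-- The matrix `R`, with rows indexed by `i = 1,…,m` and columns by `l = 0,…,m−1`. -/
noncomputable def Rmat (m q : ℕ) (p : ℤ) (A : ℂ) : Matrix (Fin m) (Fin m) ℂ :=
  fun i l => Rent m q p A ((i : ℕ) + 1) (l : ℕ)

theorem rho_eq_iff {m n i : ℕ} (hi : 1 ≤ i) (him : i ≤ m) :
    rho (2*m+1) n = i ↔
      ((2*m+1 : ℕ) : ℤ) ∣ (n : ℤ) - i ∨ ((2*m+1 : ℕ) : ℤ) ∣ (n : ℤ) + i := by
  have hlt : n % (2*m+1) < 2*m+1 := Nat.mod_lt _ (by omega)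
  have hdiv : ((2*m+1 : ℕ) : ℤ) * ((n / (2*m+1) : ℕ) : ℤ) + ((n % (2*m+1) : ℕ) : ℤ) = n := by
    exact_mod_cast Nat.div_add_mod n (2*m+1)
  have hsub : ((2*m+1 : ℕ) : ℤ) ∣ (n : ℤ) - i ↔
      ((2*m+1 : ℕ) : ℤ) ∣ ((n % (2*m+1) : ℕ) : ℤ) - i := by
    rw [← hdiv, add_sub_assoc]
    exact dvd_add_right (dvd_mul_right _ _)
  have hadd : ((2*m+1 : ℕ) : ℤ) ∣ (n : ℤ) + i ↔
      ((2*m+1 : ℕ) : ℤ) ∣ ((n % (2*m+1) : ℕ) : ℤ) + i := by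
    rw [← hdiv, add_assoc]
    exact dvd_add_right (dvd_mul_right _ _)
  rw [hsub, hadd]
  unfold rho
  generalize n % (2*m+1) = k at hlt
  constructor
  · intro h
    rcases le_total k (2*m+1-k) with h' | h'
    · rw [min_eq_left h'] at h
      left; exact ⟨0, by omega⟩
    · rw [min_eq_right h'] at h
      right; exact ⟨1, by omega⟩
  · rintro (h | h)
    · have := Int.eq_zero_of_abs_lt_dvd h (by rw [abs_lt]; omega)
      omega
    · have h2 : ((2*m+1 : ℕ) : ℤ) ∣ (k : ℤ) + i - (2*m+1 : ℕ) := dvd_sub_self_right.mpr h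
      have := Int.eq_zero_of_abs_lt_dvd h2 (by rw [abs_lt]; omega)
      omega

theorem sgn_ne_zero (r n : ℕ) : ((sgn r n : ℤ) : ℂ) ≠ 0 := by
  simp [sgn]

/-- `q * l ≡ ± a` modulo `r`. -/
def SignedCongr (r q l : ℕ) (a : ℤ) : Prop :=
  (r : ℤ) ∣ (q : ℤ) * l - a ∨ (r : ℤ) ∣ (q : ℤ) * l + a

theorem SignedCongr.existsUnique {m q : ℕ} (hco : Nat.Coprime (2*m+1) q) (a : ℤ) :
    ∃! l : ℕ, l ≤ m ∧ SignedCongr (2*m+1) q l a := by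
  have hcoZ : IsCoprime ((2*m+1 : ℕ) : ℤ) (q : ℤ) := Nat.isCoprime_iff_coprime.mpr hco
  obtain ⟨u, v, huv⟩ := hcoZ
  have hr : (0 : ℤ) < ((2*m+1 : ℕ) : ℤ) := by omega
  refine existsUnique_of_exists_of_unique ?_ ?_
  · have h0 := Int.emod_nonneg (v * a) hr.ne'
    have h1 := Int.emod_lt_of_pos (v * a) hr
    have h2 := Int.emod_add_mul_ediv (v * a) ((2*m+1 : ℕ) : ℤ)
    generalize (v * a) % ((2*m+1 : ℕ) : ℤ) = k at h0 h1 h2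
    generalize (v * a) / ((2*m+1 : ℕ) : ℤ) = t at h2
    have hk : ((2*m+1 : ℕ) : ℤ) ∣ (q : ℤ) * k - a :=
      ⟨-(q * t) - u * a, by linear_combination (q : ℤ) * h2 + a * huv⟩
    by_cases hkm : k ≤ m
    · refine ⟨k.toNat, by omega, Or.inl ?_⟩
      rwa [Int.toNat_of_nonneg h0]
    · refine ⟨(((2*m+1 : ℕ) : ℤ) - k).toNat, by omega, Or.inr ?_⟩
      rw [Int.toNat_of_nonneg (by omega)]
      obtain ⟨c, hc⟩ := hk
      exact ⟨q - c, by linear_combination -hc⟩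
  · rintro l l' ⟨hl, h⟩ ⟨hl', h'⟩
    have key : ((2*m+1 : ℕ) : ℤ) ∣ (q : ℤ) * ((l : ℤ) - l') ∨
        ((2*m+1 : ℕ) : ℤ) ∣ (q : ℤ) * ((l : ℤ) + l') := by
      rcases h with ⟨c, hc⟩ | ⟨c, hc⟩ <;> rcases h' with ⟨d, hd⟩ | ⟨d, hd⟩
      · exact Or.inl ⟨c - d, by linear_combination hc - hd⟩
      · exact Or.inr ⟨c + d, by linear_combination hc + hd⟩
      · exact Or.inr ⟨c + d, by linear_combination hc + hd⟩
      · exact Or.inl ⟨c - d, by linear_combination hc - hd⟩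
    rcases key with h | h
    · have := Int.eq_zero_of_abs_lt_dvd
        (IsCoprime.dvd_of_dvd_mul_left ⟨u, v, huv⟩ h) (by rw [abs_lt]; omega)
      omega
    · have := Int.eq_zero_of_abs_lt_dvd
        (IsCoprime.dvd_of_dvd_mul_left ⟨u, v, huv⟩ h) (by rw [abs_lt]; omega)
      omega

theorem SignedCongr.eq_or_add_eq {m q l : ℕ} {a b : ℤ}
    (ha : SignedCongr (2*m+1) q l a) (hb : SignedCongr (2*m+1) q l b) :
    ((2*m+1 : ℕ) : ℤ) ∣ a - b ∨ ((2*m+1 : ℕ) : ℤ) ∣ a + b := by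
  rcases ha with ⟨c, hc⟩ | ⟨c, hc⟩ <;> rcases hb with ⟨d, hd⟩ | ⟨d, hd⟩
  · exact Or.inl ⟨d - c, by linear_combination hd - hc⟩
  · exact Or.inr ⟨d - c, by linear_combination hd - hc⟩
  · exact Or.inr ⟨c - d, by linear_combination hc - hd⟩
  · exact Or.inl ⟨c - d, by linear_combination hc - hd⟩

theorem SignedCongr.not_pred_and_succ {m q l i : ℕ} (hi : 1 ≤ i) (him : i ≤ m) (hm : 2 ≤ m)
    (h₁ : SignedCongr (2*m+1) q l ((i : ℤ) - 1)) (h₂ : SignedCongr (2*m+1) q l ((i : ℤ) + 1)) :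
    False := by
  rcases h₁.eq_or_add_eq h₂ with h | h
  · have := Int.eq_zero_of_abs_lt_dvd h (by rw [abs_lt]; omega)
    omega
  · have := Int.eq_zero_of_abs_lt_dvd h (by rw [abs_lt]; omega)
    omega

/-- Since `2m ≡ -1` modulo `2m+1`, the condition at `l = m` reads `q ≡ ± 2a`. -/
theorem SignedCongr.cases_of_last {m q : ℕ} {a : ℤ} (h : SignedCongr (2*m+1) q m a)
    (hq : 3 ≤ q) (hmq : q + 5 < 2*m) (ha : 0 ≤ a) (ham : a ≤ m + 1) :
    (q : ℤ) = 2 * a ∨ (q : ℤ) + 2 * a = 2 * m + 1 := by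
  have key : ((2*m+1 : ℕ) : ℤ) ∣ (q : ℤ) + 2 * a ∨ ((2*m+1 : ℕ) : ℤ) ∣ (q : ℤ) - 2 * a := by
    rcases h with ⟨c, hc⟩ | ⟨c, hc⟩
    · exact Or.inl ⟨q - 2 * c, by push_cast at hc ⊢; linear_combination -2 * hc⟩
    · exact Or.inr ⟨q - 2 * c, by push_cast at hc ⊢; linear_combination -2 * hc⟩
  rcases key with h | h
  · have := Int.eq_zero_of_abs_lt_dvd (dvd_sub_self_right.mpr h) (by rw [abs_lt]; omega)
    omega
  · have := Int.eq_zero_of_abs_lt_dvd h (by rw [abs_lt]; omega)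
    omega

theorem Rent_ne_zero_iff {m q i l : ℕ} {p : ℤ} {A : ℂ} (hA : A ≠ 0) (hm : 2 ≤ m) (hq : 1 ≤ q)
    (hco : Nat.Coprime (2*m+1) q) (hl : l ≤ m) (hi : 1 ≤ i) (him : i ≤ m) :
    Rent m q p A i l ≠ 0 ↔
      SignedCongr (2*m+1) q l ((i : ℤ) - 1) ∨ SignedCongr (2*m+1) q l ((i : ℤ) + 1) := by
  unfold Rent
  by_cases hl0 : l = 0
  · subst hl0
    rw [if_pos rfl]
    have hiff : SignedCongr (2*m+1) q 0 ((i : ℤ) - 1) ∨ SignedCongr (2*m+1) q 0 ((i : ℤ) + 1) ↔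
        i = 1 := by
      constructor
      · unfold SignedCongr
        rintro ((h | h) | (h | h)) <;>
        · rw [Nat.cast_zero, mul_zero] at h
          have := Int.eq_zero_of_abs_lt_dvd h (by rw [abs_lt]; omega)
          omega
      · rintro rfl
        exact Or.inl (Or.inl ⟨0, by simp⟩)
    rw [hiff]
    simp
  · rw [if_neg hl0]
    have hql : 1 ≤ q * l := Nat.mul_pos hq (by omega)
    have hplus := rho_eq_iff (n := q*l+1) hi him
    have hminus := rho_eq_iff (n := q*l-1) hi him
    push_cast [Nat.cast_sub hql] at hplus hminus
    have hboth : ¬ (rho (2*m+1) (q*l+1) = i ∧ rho (2*m+1) (q*l-1) = i) := by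
      rw [hplus, hminus]
      rintro ⟨h₁, h₂⟩
      have hcase : ((2*m+1 : ℕ) : ℤ) ∣ 2 ∨ ((2*m+1 : ℕ) : ℤ) ∣ (q : ℤ) * (2 * l) := by
        push_cast
        rcases h₁ with ⟨c, hc⟩ | ⟨c, hc⟩ <;> rcases h₂ with ⟨d, hd⟩ | ⟨d, hd⟩
        · exact Or.inl ⟨c - d, by linear_combination hc - hd⟩
        · exact Or.inr ⟨c + d, by linear_combination hc + hd⟩
        · exact Or.inr ⟨c + d, by linear_combination hc + hd⟩
        · exact Or.inl ⟨c - d, by linear_combination hc - hd⟩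
      rcases hcase with h | h
      · have := Int.le_of_dvd (by norm_num) h
        omega
      · have := Int.le_of_dvd (by omega)
          ((Nat.isCoprime_iff_coprime.mpr hco).dvd_of_dvd_mul_left h)
        omega
    have hor : (rho (2*m+1) (q*l+1) = i ∨ rho (2*m+1) (q*l-1) = i) ↔
        SignedCongr (2*m+1) q l ((i : ℤ) - 1) ∨ SignedCongr (2*m+1) q l ((i : ℤ) + 1) := by
      rw [hplus, hminus]
      unfold SignedCongr
      push_cast
      rw [show (q : ℤ) * l + 1 - i = q * l - (i - 1) by ring,
        show (q : ℤ) * l + 1 + i = q * l + (i + 1) by ring,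
        show (q : ℤ) * l - 1 - i = q * l - (i + 1) by ring,
        show (q : ℤ) * l - 1 + i = q * l + (i - 1) by ring]
      tauto
    rw [← hor]
    by_cases h₁ : rho (2*m+1) (q*l+1) = i
    · have h₂ : ¬ rho (2*m+1) (q*l-1) = i := fun h => hboth ⟨h₁, h⟩
      simp only [h₁, h₂, if_true, if_false, mul_zero, sub_zero, true_or, iff_true]
      exact sgn_ne_zero _ _
    · by_cases h₂ : rho (2*m+1) (q*l-1) = i
      · simp only [h₁, h₂, if_true, if_false, zero_sub, or_true, iff_true]
        exact neg_ne_zero.mpr (mul_ne_zero (zpow_ne_zero _ hA) (sgn_ne_zero _ _))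
      · simp [h₁, h₂]

/-- Except for rows `i₋` and `i₊`, every row of `R` contains exactly two nonzero
entries, where `i₋ = q/2 − 1`, `i₊ = q/2 + 1` for even `q`, and `i₋ = m − (q+1)/2`,
`i₊ = m − (q−3)/2` for odd `q`. -/
theorem stmt_8 (m q : ℕ) (hm : 0 < m) (hq3 : 3 ≤ q)
    (hco : Nat.Coprime (2*m+1) q) (hmq : q + 5 < 2*m) (p : ℤ) (A : ℂ)
    (hA : IsPrimitiveRoot A (2*(2*m+1))) :
    ∀ i : ℕ, 1 ≤ i → i ≤ m →
      i ≠ (if q % 2 = 0 then q/2 - 1 else m - (q+1)/2) →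
      i ≠ (if q % 2 = 0 then q/2 + 1 else m - (q-3)/2) →
      ((Finset.range m).filter (fun l => Rent m q p A i l ≠ 0)).card = 2 := by
  intro i hi him hminus hplus
  obtain ⟨l₁, ⟨hl₁, hc₁⟩, hu₁⟩ := SignedCongr.existsUnique hco ((i : ℤ) - 1)
  obtain ⟨l₂, ⟨hl₂, hc₂⟩, hu₂⟩ := SignedCongr.existsUnique hco ((i : ℤ) + 1)
  have hne : l₁ ≠ l₂ := by
    rintro rfl
    exact SignedCongr.not_pred_and_succ hi him (by omega) hc₁ hc₂
  have hlt₁ : l₁ < m := by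
    refine lt_of_le_of_ne hl₁ ?_
    rintro rfl
    have := hc₁.cases_of_last hq3 hmq (by omega) (by omega)
    split_ifs at hminus hplus <;> omega
  have hlt₂ : l₂ < m := by
    refine lt_of_le_of_ne hl₂ ?_
    rintro rfl
    have := hc₂.cases_of_last hq3 hmq (by omega) (by omega)
    split_ifs at hminus hplus <;> omega
  have hA0 : A ≠ 0 := hA.ne_zero (by omega)
  rw [Finset.card_eq_two]
  refine ⟨l₁, l₂, hne, ?_⟩
  ext l
  rw [Finset.mem_filter, Finset.mem_range, Finset.mem_insert, Finset.mem_singleton]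
  constructor
  · rintro ⟨hl, h⟩
    rw [Rent_ne_zero_iff hA0 (by omega) (by omega) hco hl.le hi him] at h
    exact h.imp (fun h => hu₁ l ⟨hl.le, h⟩) (fun h => hu₂ l ⟨hl.le, h⟩)
  · rintro (rfl | rfl)
    · exact ⟨hlt₁, (Rent_ne_zero_iff hA0 (by omega) (by omega) hco hl₁ hi him).mpr (Or.inl hc₁)⟩
    · exact ⟨hlt₂, (Rent_ne_zero_iff hA0 (by omega) (by omega) hco hl₂ hi him).mpr (Or.inr hc₂)⟩
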